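/- arXiv:1003.4039 — 3 statements merged into one kernel-verified Lean document; each statement's English description precedes it below -/
import Mathlib

section
/- Let 0 < a < 1/2. For every real number x, one has |x|^{1/2-a}·|1 - x²|^a ≤ M_R · max(1, |x|), where M_R = (4a)^a·(1-2a)^{1/4 - a/2}·(1+2a)^{-1/4 - a/2}. In other words, the global maximum of f(x)/max(1,|x|) on the real axis is M_R. -/
/-- The maximum of `s ^ p * (1 - s) ^ q` on `[0, 1]` is attained at `s = p / (p + q)`. -/
theorem rpow_mul_one_sub_rpow_le {p q s : ℝ} (hp : 0 < p) (hq : 0 < q)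
    (hs0 : 0 ≤ s) (hs1 : s ≤ 1) :
    s ^ p * (1 - s) ^ q ≤ (p / (p + q)) ^ p * (q / (p + q)) ^ q := by
  have hr : 0 < p + q := add_pos hp hq
  set u := p / (p + q) with hu
  set v := q / (p + q) with hv
  have hu0 : 0 < u := div_pos hp hr
  have hv0 : 0 < v := div_pos hq hr
  have huv : u + v = 1 := by rw [hu, hv]; field_simp
  have hsu : 0 ≤ s / u := div_nonneg hs0 hu0.le
  have hsv : 0 ≤ (1 - s) / v := div_nonneg (sub_nonneg.2 hs1) hv0.le
  have key := Real.geom_mean_le_arith_mean2_weighted hu0.le hv0.le hsu hsv huv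
  rw [mul_div_cancel₀ _ hu0.ne', mul_div_cancel₀ _ hv0.ne', add_sub_cancel] at key
  have h := Real.rpow_le_one (by positivity) key hr.le
  rw [Real.mul_rpow (by positivity) (by positivity), ← Real.rpow_mul hsu, ← Real.rpow_mul hsv,
    hu, hv, div_mul_cancel₀ _ hr.ne', div_mul_cancel₀ _ hr.ne', ← hu, ← hv,
    Real.div_rpow hs0 hu0.le, Real.div_rpow (sub_nonneg.2 hs1) hv0.le, div_mul_div_comm,
    div_le_one (by positivity)] at h
  exact h

/-- For `0 < a < 1/2`, the function `f(x) = |x|^(1/2-a)·|1-x²|^a` on the real axis satisfies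
`f(x) ≤ M_R · max(1,|x|)` where `M_R = (4a)^a·(1-2a)^(1/4-a/2)·(1+2a)^(-1/4-a/2)`. -/
theorem max_on_real_axis (a : ℝ) (ha0 : 0 < a) (ha : a < 1 / 2) :
    ∀ x : ℝ, |x| ^ (1 / 2 - a) * |1 - x ^ 2| ^ a ≤
      ((4 * a) ^ a * (1 - 2 * a) ^ (1 / 4 - a / 2) * (1 + 2 * a) ^ (-(1 / 4) - a / 2)) *
        max 1 |x| := by
  intro x
  have hp : 0 < 1 / 4 - a / 2 := by linarith
  have hd : 0 < 1 + 2 * a := by linarith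
  have hn : 0 < 1 - 2 * a := by linarith
  have hM : ((1 / 4 - a / 2) / (1 / 4 - a / 2 + a)) ^ (1 / 4 - a / 2) *
      (a / (1 / 4 - a / 2 + a)) ^ a =
      (4 * a) ^ a * (1 - 2 * a) ^ (1 / 4 - a / 2) * (1 + 2 * a) ^ (-(1 / 4) - a / 2) := by
    have h1 : (1 / 4 - a / 2) / (1 / 4 - a / 2 + a) = (1 - 2 * a) / (1 + 2 * a) := by
      rw [div_eq_div_iff (by linarith) hd.ne']; ring
    have h2 : a / (1 / 4 - a / 2 + a) = 4 * a / (1 + 2 * a) := by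
      rw [div_eq_div_iff (by linarith) hd.ne']; ring
    have h3 : -(1 / 4) - a / 2 = -((1 / 4 - a / 2) + a) := by ring
    rw [h1, h2, h3, Real.div_rpow hn.le hd.le, Real.div_rpow (by positivity) hd.le,
      Real.rpow_neg hd.le, Real.rpow_add hd]
    field_simp
  have bound : ∀ s : ℝ, 0 ≤ s → s ≤ 1 → s ^ (1 / 4 - a / 2) * (1 - s) ^ a ≤ _ :=
    fun s hs0 hs1 => (rpow_mul_one_sub_rpow_le hp ha0 hs0 hs1).trans_eq hM
  have hexp : (1 / 2 - a : ℝ) = (2 : ℕ) * (1 / 4 - a / 2) := by push_cast; ring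
  have hpow : |x| ^ (1 / 2 - a) = (x ^ 2) ^ (1 / 4 - a / 2) := by
    rw [hexp, Real.rpow_mul (abs_nonneg x), Real.rpow_natCast, sq_abs]
  rcases le_or_gt |x| 1 with hx | hx
  · have hx2 : x ^ 2 ≤ 1 := (sq_le_one_iff_abs_le_one x).2 hx
    rw [max_eq_left hx, mul_one, hpow, abs_of_nonneg (sub_nonneg.2 hx2)]
    exact bound _ (sq_nonneg x) hx2
  · have hx2 : 1 < x ^ 2 := (one_lt_sq_iff_one_lt_abs x).2 hx
    have hx0 : 0 < x ^ 2 := by linarith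
    have hs1 : (x ^ 2)⁻¹ ≤ 1 := inv_le_one_of_one_le₀ hx2.le
    have habs : |1 - x ^ 2| = x ^ 2 * (1 - (x ^ 2)⁻¹) := by
      rw [abs_of_neg (by linarith), mul_sub, mul_inv_cancel₀ hx0.ne']; ring
    have hroot : (x ^ 2) ^ (1 / 4 - a / 2) * (x ^ 2) ^ a =
        ((x ^ 2)⁻¹) ^ (1 / 4 - a / 2) * |x| := by
      rw [← Real.sqrt_sq_eq_abs, Real.sqrt_eq_rpow, Real.inv_rpow hx0.le, ← Real.rpow_neg hx0.le,
        ← Real.rpow_add hx0, ← Real.rpow_add hx0]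
      ring_nf
    rw [max_eq_right hx.le, hpow, habs, Real.mul_rpow hx0.le (sub_nonneg.2 hs1), ← mul_assoc,
      hroot, mul_right_comm]
    exact mul_le_mul_of_nonneg_right (bound _ (inv_nonneg.2 hx0.le) hs1) (abs_nonneg x)
end

section
/- Let 0 < a < 1/2 and let x₂ = √((1+2a)/(1-2a)). Then x₂ ∈ [1,∞), f(x₂)/x₂ = M_R, and f(x)/x ≤ M_R for all x ∈ [1,∞); that is, f(x)/|x| attains its global maximum M_R on the interval [1,∞) at x₂. -/
open Real in
/-- On `[1,∞)` the quotient `f(x)/x` is a function of `x²`. -/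
lemma ray_quotient_eq (a x : ℝ) (hx : 1 ≤ x) :
    |x| ^ (1 / 2 - a) * |1 - x ^ 2| ^ a / x =
      (x ^ 2 - 1) ^ a * (x ^ 2) ^ (-(1 / 4) - a / 2) := by
  have hx0 : 0 < x := by linarith
  have h1 : |1 - x ^ 2| = x ^ 2 - 1 := by
    rw [abs_of_nonpos (by nlinarith)]
    ring
  have h2 : (x ^ 2) ^ (-(1 / 4) - a / 2) = x ^ (1 / 2 - a) / x := by
    rw [← rpow_natCast, ← rpow_mul hx0.le, ← rpow_sub_one hx0.ne']
    congr 1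
    push_cast
    ring
  rw [h1, h2, abs_of_pos hx0]
  ring

open Real in
/-- The bound for `(t-1)^a t^(-1/4-a/2)`, from the weighted AM-GM inequality. -/
lemma sub_one_rpow_mul_rpow_le (a t : ℝ) (ha0 : 0 < a) (ha : a < 1 / 2) (ht : 1 ≤ t) :
    (t - 1) ^ a * t ^ (-(1 / 4) - a / 2) ≤
      (4 * a) ^ a * (1 - 2 * a) ^ (1 / 4 - a / 2) * (1 + 2 * a) ^ (-(1 / 4) - a / 2) := by
  have hp : 0 < 1 + 2 * a := by linarith
  have hm : 0 < 1 - 2 * a := by linarith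
  have h4 : 0 < 4 * a := by linarith
  have ht0 : 0 < t := by linarith
  have hu : 0 ≤ (t - 1) / (4 * a) := div_nonneg (by linarith) h4.le
  have hv : 0 ≤ 1 / (1 - 2 * a) := by positivity
  have amgm := geom_mean_le_arith_mean2_weighted (div_nonneg h4.le hp.le)
    (div_nonneg hm.le hp.le) hu hv (by field_simp; ring)
  have hsum : 4 * a / (1 + 2 * a) * ((t - 1) / (4 * a)) +
      (1 - 2 * a) / (1 + 2 * a) * (1 / (1 - 2 * a)) = t / (1 + 2 * a) := by
    rw [div_mul_eq_mul_div, div_mul_eq_mul_div, mul_div_cancel₀ _ h4.ne',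
      mul_one_div_cancel hm.ne']
    ring
  rw [hsum] at amgm
  have key := rpow_le_rpow (by positivity) amgm (show 0 ≤ (1 + 2 * a) / 4 by positivity)
  rw [mul_rpow (by positivity) (by positivity), ← rpow_mul hu, ← rpow_mul hv,
    show 4 * a / (1 + 2 * a) * ((1 + 2 * a) / 4) = a by field_simp,
    show (1 - 2 * a) / (1 + 2 * a) * ((1 + 2 * a) / 4) = 1 / 4 - a / 2 by field_simp; ring,
    div_rpow (by linarith) h4.le, div_rpow zero_le_one hm.le, one_rpow,
    div_rpow ht0.le hp.le] at key
  rw [show -(1 / 4) - a / 2 = -((1 + 2 * a) / 4) by ring, rpow_neg ht0.le, rpow_neg hp.le]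
  have hA : 0 < (4 * a) ^ a := by positivity
  have hB : 0 < (1 - 2 * a) ^ (1 / 4 - a / 2) := by positivity
  have hC : 0 < (1 + 2 * a) ^ ((1 + 2 * a) / 4) := by positivity
  have hT : 0 < t ^ ((1 + 2 * a) / 4) := by positivity
  rw [div_mul_div_comm, mul_one, div_le_div_iff₀ (by positivity) hC] at key
  rw [← div_eq_mul_inv, ← div_eq_mul_inv, div_le_div_iff₀ hT hC]
  linarith

/-- For `0 < a < 1/2` and `x₂ = √((1+2a)/(1-2a))`, the function
`f(x)/|x|` with `f(x) = |x|^(1/2-a)·|1-x²|^a` attains its global maximum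
`M_R = (4a)^a·(1-2a)^(1/4-a/2)·(1+2a)^(-1/4-a/2)` on `[1,∞)` at `x₂`. -/
theorem max_on_ray (a : ℝ) (ha0 : 0 < a) (ha : a < 1 / 2)
    (x₂ : ℝ) (hx₂ : x₂ = Real.sqrt ((1 + 2 * a) / (1 - 2 * a)))
    (f : ℝ → ℝ) (hf : f = fun x => |x| ^ (1 / 2 - a) * |1 - x ^ 2| ^ a)
    (MR : ℝ)
    (hMR : MR = (4 * a) ^ a * (1 - 2 * a) ^ (1 / 4 - a / 2) * (1 + 2 * a) ^ (-(1 / 4) - a / 2)) :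
    x₂ ∈ Set.Ici (1 : ℝ) ∧ f x₂ / x₂ = MR ∧ ∀ x ∈ Set.Ici (1 : ℝ), f x / x ≤ MR := by
  subst hf hMR
  have hp : 0 < 1 + 2 * a := by linarith
  have hm : 0 < 1 - 2 * a := by linarith
  have hsq : x₂ ^ 2 = (1 + 2 * a) / (1 - 2 * a) := by
    rw [hx₂, Real.sq_sqrt (by positivity)]
  have hx1 : 1 ≤ x₂ := by
    rw [hx₂, Real.one_le_sqrt, le_div_iff₀ hm]
    linarith
  refine ⟨hx1, ?_, fun x hx => ?_⟩
  · beta_reduce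
    rw [ray_quotient_eq a x₂ hx1, hsq,
      show (1 + 2 * a) / (1 - 2 * a) - 1 = 4 * a / (1 - 2 * a) by field_simp; ring,
      Real.div_rpow (by linarith) hm.le, Real.div_rpow hp.le hm.le]
    have hexp : (1 - 2 * a) ^ (1 / 4 - a / 2) =
        ((1 - 2 * a) ^ (-(1 / 4) - a / 2))⁻¹ / (1 - 2 * a) ^ a := by
      rw [← Real.rpow_neg hm.le, ← Real.rpow_sub hm]
      ring_nf
    rw [hexp]
    ring
  · have hx' : 1 ≤ x := hx
    beta_reduce
    rw [ray_quotient_eq a x hx']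
    exact sub_one_rpow_mul_rpow_le a (x ^ 2) ha0 ha (by nlinarith)
end

section
/- Let 0 < R ≤ 1 and set a = (1/2)·(1 + 4^{1/R})^{-1/2}. Then 0 < a < 1/2 and M_R^{-R} · M_C^{R-1} = ((2^{1-1/R} + √(4^{1-1/R} + 4))/2)^{R/2}, where M_C = 2^a and M_R = (4a)^a·(1-2a)^{1/4 - a/2}·(1+2a)^{-1/4 - a/2}. Equivalently, (4a)^{-aR}·(1-2a)^{(a/2 - 1/4)R}·(1+2a)^{(a/2 + 1/4)R}·2^{a(R-1)} = ((2^{1-1/R} + √(4^{1-1/R} + 4))/2)^{R/2}. -/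
/-- For `0 < R ≤ 1` and `a = (1/2)·(1 + 4^(1/R))^(-1/2)`, one has `0 < a < 1/2` and
`M_R^(-R) · M_C^(R-1) = ((2^(1-1/R) + √(4^(1-1/R)+4))/2)^(R/2)`, with `M_C = 2^a` and
`M_R = (4a)^a·(1-2a)^(1/4-a/2)·(1+2a)^(-1/4-a/2)`; equivalently,
`(4a)^(-aR)·(1-2a)^((a/2-1/4)R)·(1+2a)^((a/2+1/4)R)·2^(a(R-1))` equals the same value. -/
theorem optimal_choice_of_a (R : ℝ) (hR0 : 0 < R) (hR1 : R ≤ 1)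
    (a : ℝ) (haval : a = 1 / 2 * (1 + (4 : ℝ) ^ (1 / R)) ^ (-(1 / 2) : ℝ))
    (MC MR : ℝ) (hMC : MC = (2 : ℝ) ^ a)
    (hMR : MR = (4 * a) ^ a * (1 - 2 * a) ^ (1 / 4 - a / 2) * (1 + 2 * a) ^ (-(1 / 4) - a / 2)) :
    0 < a ∧ a < 1 / 2 ∧
    MR ^ (-R) * MC ^ (R - 1) =
      (((2 : ℝ) ^ (1 - 1 / R) + Real.sqrt ((4 : ℝ) ^ (1 - 1 / R) + 4)) / 2) ^ (R / 2) ∧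
    (4 * a) ^ (-(a * R)) * (1 - 2 * a) ^ ((a / 2 - 1 / 4) * R) *
        (1 + 2 * a) ^ ((a / 2 + 1 / 4) * R) * (2 : ℝ) ^ (a * (R - 1)) =
      (((2 : ℝ) ^ (1 - 1 / R) + Real.sqrt ((4 : ℝ) ^ (1 - 1 / R) + 4)) / 2) ^ (R / 2) := by
  set t : ℝ := (2 : ℝ) ^ (1 / R) with ht
  have htpos : 0 < t := by positivity
  have hfour (x : ℝ) : (4 : ℝ) ^ x = ((2 : ℝ) ^ x) ^ 2 := by
    rw [show (4 : ℝ) = 2 ^ (2 : ℕ) by norm_num, ← Real.rpow_natCast, ← Real.rpow_mul (by norm_num),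
      mul_comm, Real.rpow_mul (by norm_num), Real.rpow_natCast]
  have hlogt : Real.log 2 = R * Real.log t := by
    rw [ht, Real.log_rpow two_pos]
    field_simp
  set s : ℝ := Real.sqrt (1 + t ^ 2) with hs
  have hssq : s ^ 2 = 1 + t ^ 2 := Real.sq_sqrt (by positivity)
  have hs1 : 1 < s := by
    rw [hs, Real.lt_sqrt zero_le_one]
    nlinarith
  have hspos : 0 < s := one_pos.trans hs1
  have ha : a = 1 / (2 * s) := by
    rw [haval, hfour, ← ht, Real.rpow_neg (by positivity), ← Real.sqrt_eq_rpow, ← hs]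
    field_simp
  have ha0 : 0 < a := by rw [ha]; positivity
  have ha2 : a < 1 / 2 := by
    rw [ha]
    exact one_div_lt_one_div_of_lt two_pos (by linarith)
  have hm : 0 < 1 - 2 * a := by linarith
  have hp : 0 < 1 + 2 * a := by linarith
  have htwo : (2 : ℝ) ^ (1 - 1 / R) = 2 / t := by
    rw [Real.rpow_sub two_pos, Real.rpow_one]
  have hsqrt : Real.sqrt ((4 : ℝ) ^ (1 - 1 / R) + 4) = 2 * s / t := by
    rw [hfour, htwo, Real.sqrt_eq_iff_mul_self_eq (by positivity) (by positivity)]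
    field_simp
    linear_combination -4 * hssq
  have hbase : ((2 : ℝ) ^ (1 - 1 / R) + Real.sqrt ((4 : ℝ) ^ (1 - 1 / R) + 4)) / 2
      = (s + 1) / t := by
    rw [hsqrt, htwo]
    field_simp
    ring
  have hlog4a : Real.log (4 * a) = Real.log 2 - Real.log s := by
    rw [← Real.log_div two_ne_zero hspos.ne', ha]
    congr 1
    field_simp
    norm_num
  have hlogp : Real.log (1 + 2 * a) = Real.log (s + 1) - Real.log s := by
    rw [← Real.log_div (by positivity) hspos.ne', ha]
    congr 1
    field_simp
  have hlogm : Real.log (1 - 2 * a) = 2 * Real.log t - Real.log (s + 1) - Real.log s := by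
    have h : 1 - 2 * a = t ^ 2 / (s + 1) / s := by
      rw [ha]
      field_simp
      linear_combination hssq
    rw [h, Real.log_div (by positivity) hspos.ne', Real.log_div (by positivity) (by positivity),
      Real.log_pow]
    norm_num
  have key : (4 * a) ^ (-(a * R)) * (1 - 2 * a) ^ ((a / 2 - 1 / 4) * R) *
        (1 + 2 * a) ^ ((a / 2 + 1 / 4) * R) * (2 : ℝ) ^ (a * (R - 1)) =
      ((s + 1) / t) ^ (R / 2) := by
    rw [Real.rpow_def_of_pos (by positivity : 0 < 4 * a), Real.rpow_def_of_pos hm,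
      Real.rpow_def_of_pos hp, Real.rpow_def_of_pos two_pos,
      Real.rpow_def_of_pos (by positivity : 0 < (s + 1) / t), ← Real.exp_add, ← Real.exp_add,
      ← Real.exp_add, hlog4a, hlogp, hlogm, Real.log_div (by positivity) htpos.ne']
    congr 1
    linear_combination -a * hlogt
  refine ⟨ha0, ha2, ?_, by rw [hbase, key]⟩
  rw [hbase, ← key, hMR, hMC, Real.mul_rpow (by positivity) (by positivity),
    Real.mul_rpow (by positivity) (by positivity), ← Real.rpow_mul (by positivity),
    ← Real.rpow_mul hm.le, ← Real.rpow_mul hp.le, ← Real.rpow_mul two_pos.le]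
  rw [show a * -R = -(a * R) by ring, show (1 / 4 - a / 2) * -R = (a / 2 - 1 / 4) * R by ring,
    show (-(1 / 4) - a / 2) * -R = (a / 2 + 1 / 4) * R by ring]
end
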